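/- Define C^{10}_{j_2 j_1} = ∫_t^T φ_{j_2}(t_2) ∫_t^{t_2} (t−t_1) φ_{j_1}(t_1) dt_1 dt_2 and C_{j_2 j_1} = ∫_t^T φ_{j_2}(y) ∫_t^y φ_{j_1}(x) dx dy. Then C^{10}_{j_2 j_1} = −(Δ/2)·C_{j_2 j_1} − (Δ²/4)·B_{j_2 j_1}, where B_{0,1} = 1/√3; for every integer i ≥ 0: B_{i+2, i} = (i+1)/((2i+3)√((2i+1)(2i+5))), B_{i, i+2} = −(i+2)/((2i+3)√((2i+1)(2i+5))), and B_{i, i} = 1/((2i−1)(2i+3)); and B_{j_2 j_1} = 0 for all other pairs (j_2, j_1). -/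

import Mathlib

open MeasureTheory

/-- The `n`-th Legendre polynomial, given by Rodrigues' formula
`P_n(x) = (1/(2^n n!)) (d/dx)^n (x²−1)^n`. -/
noncomputable def legendreP (n : ℕ) (x : ℝ) : ℝ :=
  (1 / ((2 : ℝ) ^ n * (Nat.factorial n))) * iteratedDeriv n (fun y => (y ^ 2 - 1) ^ n) x

open Polynomial

/-- The normalising constant `1 / (2 ^ n * n!)` in Rodrigues' formula. -/
noncomputable def legendreCoeff (n : ℕ) : ℝ := 1 / ((2 : ℝ) ^ n * (Nat.factorial n))

/-- The `n`-th Legendre polynomial, as a polynomial. -/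
noncomputable def legendrePoly (n : ℕ) : ℝ[X] :=
  C (legendreCoeff n) * derivative^[n] ((X ^ 2 - 1) ^ n)

theorem iteratedDeriv_polynomial_eval (p : ℝ[X]) (n : ℕ) :
    iteratedDeriv n (fun y => p.eval y) = fun y => (derivative^[n] p).eval y := by
  induction n with
  | zero => simp
  | succ n ih =>
    rw [iteratedDeriv_succ, ih, Function.iterate_succ_apply']
    ext y
    exact Polynomial.deriv _

theorem legendreP_eq_eval (n : ℕ) (x : ℝ) : legendreP n x = (legendrePoly n).eval x := by
  have h := congrFun (iteratedDeriv_polynomial_eval ((X ^ 2 - 1) ^ n) n) x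
  simp only [eval_pow, eval_sub, eval_X, eval_one] at h
  rw [legendreP, legendrePoly, legendreCoeff, h, eval_mul, eval_C]

theorem legendrePoly_zero : legendrePoly 0 = 1 := by simp [legendrePoly, legendreCoeff]

theorem C_legendreCoeff_succ_mul (n : ℕ) :
    C (legendreCoeff (n + 1)) * (2 * ((n : ℝ[X]) + 1)) = C (legendreCoeff n) := by
  rw [show (2 * ((n : ℝ[X]) + 1)) = C (2 * ((n : ℝ) + 1)) by simp [map_ofNat C 2], ← C_mul]
  congr 1
  rw [legendreCoeff, legendreCoeff, Nat.factorial_succ]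
  push_cast
  field_simp
  ring

theorem derivative_sq_sub_one_pow_succ (n : ℕ) :
    derivative ((X ^ 2 - 1 : ℝ[X]) ^ (n + 1)) =
      C (2 * ((n : ℝ) + 1)) * (X * (X ^ 2 - 1) ^ n) := by
  rw [derivative_pow_succ]
  simp [map_ofNat C 2]
  ring

theorem legendrePoly_succ_eq (n : ℕ) : legendrePoly (n + 1) =
    C (legendreCoeff n) * derivative^[n] (X * (X ^ 2 - 1) ^ n) := by
  rw [legendrePoly, Function.iterate_succ_apply, derivative_sq_sub_one_pow_succ,
    iterate_derivative_C_mul, ← C_legendreCoeff_succ_mul n]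
  simp only [map_mul, map_add, map_natCast, map_ofNat, map_one]
  ring

theorem legendrePoly_one : legendrePoly 1 = X := by
  simp [legendrePoly_succ_eq, legendreCoeff]

theorem legendrePoly_succ_succ_eq (n : ℕ) : legendrePoly (n + 2) =
    X * legendrePoly (n + 1) + C (legendreCoeff (n + 1)) * (((n : ℝ[X]) + 1) *
      derivative^[n] ((X ^ 2 - 1) ^ (n + 1))) := by
  rw [legendrePoly_succ_eq, mul_comm X, iterate_derivative_mul_X, legendrePoly]
  simp only [nsmul_eq_mul, Nat.add_sub_cancel]
  push_cast
  ring

theorem derivative_legendrePoly_succ (n : ℕ) : derivative (legendrePoly (n + 1)) =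
    X * derivative (legendrePoly n) + ((n : ℝ[X]) + 1) * legendrePoly n := by
  cases n with
  | zero => simp [legendrePoly_zero, legendrePoly_one]
  | succ n =>
    have h : derivative ((n : ℝ[X]) + 1) = 0 := by simp
    rw [legendrePoly_succ_succ_eq, derivative_add, derivative_mul, derivative_C_mul,
      derivative_mul, h, derivative_X, ← Function.iterate_succ_apply' derivative]
    have h₂ : C (legendreCoeff (n + 1)) * derivative^[n + 1] ((X ^ 2 - 1) ^ (n + 1)) =
        legendrePoly (n + 1) := rfl
    push_cast
    linear_combination ((n : ℝ[X]) + 1) * h₂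

theorem derivative_legendrePoly_add_two (n : ℕ) : derivative (legendrePoly (n + 2)) =
    (2 * (n : ℝ[X]) + 3) * legendrePoly (n + 1) + derivative (legendrePoly n) := by
  have h : derivative (X * (X ^ 2 - 1 : ℝ[X]) ^ (n + 1)) =
      C (2 * (n : ℝ) + 3) * (X ^ 2 - 1) ^ (n + 1) + C (2 * ((n : ℝ) + 1)) * (X ^ 2 - 1) ^ n := by
    rw [derivative_mul, derivative_sq_sub_one_pow_succ]
    simp only [map_mul, map_add, map_natCast, map_ofNat, map_one, derivative_X]
    ring
  rw [legendrePoly_succ_eq, derivative_C_mul, ← Function.iterate_succ_apply' derivative,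
    Function.iterate_succ_apply, h, iterate_map_add, iterate_derivative_C_mul,
    iterate_derivative_C_mul, legendrePoly, legendrePoly, derivative_C_mul,
    ← Function.iterate_succ_apply' derivative, ← C_legendreCoeff_succ_mul n]
  simp only [map_mul, map_add, map_natCast, map_ofNat, map_one]
  ring

theorem X_mul_derivative_legendrePoly_succ (n : ℕ) : X * derivative (legendrePoly (n + 1)) =
    ((n : ℝ[X]) + 1) * legendrePoly (n + 1) + derivative (legendrePoly n) := by
  have h₁ := derivative_legendrePoly_succ (n + 1)
  have h₂ := derivative_legendrePoly_add_two n
  push_cast at h₁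
  linear_combination h₂ - h₁

theorem eval_legendrePoly_succ_of_sq_eq_one {a : ℝ} (ha : a ^ 2 = 1) (n : ℕ) :
    (legendrePoly (n + 1)).eval a = a * (legendrePoly n).eval a := by
  cases n with
  | zero => simp [legendrePoly_zero, legendrePoly_one]
  | succ n =>
    have h : (X - C a) ∣ derivative^[n] ((X ^ 2 - 1 : ℝ[X]) ^ (n + 1)) := by
      have h₁ : (X - C a) ∣ (X ^ 2 - 1 : ℝ[X]) := by simp [dvd_iff_isRoot, ha]
      have h₂ := pow_sub_dvd_iterate_derivative_of_pow_dvd n (pow_dvd_pow_of_dvd h₁ (n + 1))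
      simpa using h₂
    rw [dvd_iff_isRoot, IsRoot.def] at h
    rw [legendrePoly_succ_succ_eq, eval_add, eval_mul, eval_mul, eval_mul, h, eval_X]
    ring

theorem eval_legendrePoly_of_sq_eq_one {a : ℝ} (ha : a ^ 2 = 1) (n : ℕ) :
    (legendrePoly n).eval a = a ^ n := by
  induction n with
  | zero => simp [legendrePoly_zero]
  | succ n ih => rw [eval_legendrePoly_succ_of_sq_eq_one ha, ih, pow_succ']

theorem eq_of_derivative_eq_of_eval_eq {p q : ℝ[X]} (h : derivative p = derivative q) {a : ℝ}
    (ha : p.eval a = q.eval a) : p = q := by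
  have h₁ : derivative (p - q) = 0 := by rw [derivative_sub, h, sub_self]
  have h₂ := eq_C_of_derivative_eq_zero h₁
  have h₃ : (p - q).eval a = 0 := by rw [eval_sub, ha, sub_self]
  rw [h₂, eval_C] at h₃
  rw [h₃, C_0] at h₂
  exact sub_eq_zero.mp h₂

/-- Bonnet's recurrence. -/
theorem legendrePoly_recurrence (n : ℕ) : ((n : ℝ[X]) + 2) * legendrePoly (n + 2) =
    (2 * (n : ℝ[X]) + 3) * (X * legendrePoly (n + 1)) - ((n : ℝ[X]) + 1) * legendrePoly n := by
  apply eq_of_derivative_eq_of_eval_eq (a := 1)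
  · have h₁ := X_mul_derivative_legendrePoly_succ n
    have h₂ := derivative_legendrePoly_add_two n
    simp [derivative_mul]
    linear_combination ((n : ℝ[X]) + 2) * h₂ - (2 * (n : ℝ[X]) + 3) * h₁
  · simp [eval_legendrePoly_of_sq_eq_one]
    ring

theorem derivative_sq_sub_one_mul_derivative_legendrePoly (n : ℕ) :
    derivative ((X ^ 2 - 1) * derivative (legendrePoly n)) =
      (n : ℝ[X]) * ((n : ℝ[X]) + 1) * legendrePoly n := by
  cases n with
  | zero => simp [legendrePoly_zero]
  | succ n =>
    have h₁ := derivative_legendrePoly_succ n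
    have h₂ := X_mul_derivative_legendrePoly_succ n
    have h₃ : (X ^ 2 - 1) * derivative (legendrePoly (n + 1)) =
        ((n : ℝ[X]) + 1) * (X * legendrePoly (n + 1) - legendrePoly n) := by
      linear_combination X * h₂ - h₁
    rw [h₃]
    simp [derivative_mul]
    linear_combination ((n : ℝ[X]) + 1) * h₂

/-- Integration of polynomials over `[-1, 1]`. -/
noncomputable def polyIntegral : ℝ[X] →ₗ[ℝ] ℝ where
  toFun p := ∫ x in (-1 : ℝ)..1, p.eval x
  map_add' p q := by
    simp only [eval_add]
    exact intervalIntegral.integral_add (p.continuous.intervalIntegrable _ _)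
      (q.continuous.intervalIntegrable _ _)
  map_smul' c p := by simp

theorem polyIntegral_apply (p : ℝ[X]) : polyIntegral p = ∫ x in (-1 : ℝ)..1, p.eval x := rfl

theorem integral_eval_derivative (p : ℝ[X]) (a b : ℝ) :
    ∫ x in a..b, (derivative p).eval x = p.eval b - p.eval a :=
  intervalIntegral.integral_eq_sub_of_hasDerivAt (fun x _ => p.hasDerivAt x)
    ((derivative p).continuous.intervalIntegrable _ _)

theorem polyIntegral_C_mul (c : ℝ) (p : ℝ[X]) : polyIntegral (C c * p) = c * polyIntegral p := by
  rw [← smul_eq_C_mul, map_smul, smul_eq_mul]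

theorem polyIntegral_legendrePoly_mul_of_ne {m n : ℕ} (h : m ≠ n) :
    polyIntegral (legendrePoly m * legendrePoly n) = 0 := by
  have h₁ : derivative ((X ^ 2 - 1) * (derivative (legendrePoly m) * legendrePoly n -
      legendrePoly m * derivative (legendrePoly n))) =
      C ((m : ℝ) * (m + 1) - n * (n + 1)) * (legendrePoly m * legendrePoly n) := by
    have hm := derivative_sq_sub_one_mul_derivative_legendrePoly m
    have hn := derivative_sq_sub_one_mul_derivative_legendrePoly n
    simp only [derivative_mul, derivative_sub] at hm hn ⊢
    simp only [C_sub, C_mul, C_add, C_1, map_natCast]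
    linear_combination legendrePoly n * hm - legendrePoly m * hn
  have h₂ := polyIntegral_C_mul ((m : ℝ) * (m + 1) - n * (n + 1)) (legendrePoly m * legendrePoly n)
  rw [← h₁, polyIntegral_apply, integral_eval_derivative] at h₂
  simp only [eval_mul, eval_sub, eval_pow, eval_X, eval_one] at h₂
  have h₃ : ((m : ℝ) * (m + 1) - n * (n + 1)) ≠ 0 := by
    rw [show ((m : ℝ) * (m + 1) - n * (n + 1)) = (m - n) * (m + n + 1) by ring]
    exact mul_ne_zero (sub_ne_zero.mpr (by exact_mod_cast h)) (by positivity)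
  refine (mul_eq_zero.mp ?_).resolve_left h₃
  rw [← h₂]
  ring

theorem polyIntegral_legendrePoly_mul_self (n : ℕ) :
    polyIntegral (legendrePoly n * legendrePoly n) = 2 / (2 * (n : ℝ) + 1) := by
  have hone : polyIntegral 1 = 2 := by
    rw [polyIntegral_apply]
    norm_num
  have hrec (n : ℕ) (p : ℝ[X]) :
      ((n : ℝ) + 2) * polyIntegral (legendrePoly (n + 2) * p) =
        (2 * n + 3) * polyIntegral (X * legendrePoly (n + 1) * p) -
          ((n : ℝ) + 1) * polyIntegral (legendrePoly n * p) := by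
    rw [← polyIntegral_C_mul, ← polyIntegral_C_mul, ← polyIntegral_C_mul, ← map_sub]
    congr 1
    simp only [map_mul, map_add, map_natCast, map_ofNat, map_one]
    linear_combination p * legendrePoly_recurrence n
  induction n with
  | zero => simpa [legendrePoly_zero] using hone
  | succ n ih =>
    have h₁ := hrec n (legendrePoly n)
    rw [polyIntegral_legendrePoly_mul_of_ne (by omega), ih, mul_zero] at h₁
    have h₂ : ((n : ℝ) + 1) * polyIntegral (legendrePoly (n + 1) * legendrePoly (n + 1)) =
        (2 * n + 1) * polyIntegral (X * legendrePoly (n + 1) * legendrePoly n) := by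
      cases n with
      | zero => simp [legendrePoly_zero, legendrePoly_one]
      | succ n =>
        have h₃ := hrec n (legendrePoly (n + 2))
        rw [polyIntegral_legendrePoly_mul_of_ne (m := n) (by omega), mul_zero, sub_zero,
          mul_right_comm] at h₃
        push_cast
        linear_combination h₃
    push_cast
    have h₄ : polyIntegral (X * legendrePoly (n + 1) * legendrePoly n) =
        (2 / (2 * (n : ℝ) + 1)) * (n + 1) / (2 * n + 3) := by
      field_simp at h₁ ⊢
      linear_combination -h₁
    rw [h₄] at h₂
    have hn : (n : ℝ) + 1 ≠ 0 := by positivity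
    apply mul_left_cancel₀ hn
    rw [h₂]
    field_simp
    ring

theorem polyIntegral_legendrePoly_mul (m n : ℕ) :
    polyIntegral (legendrePoly m * legendrePoly n) = if m = n then 2 / (2 * (n : ℝ) + 1) else 0 := by
  split_ifs with h
  · rw [h, polyIntegral_legendrePoly_mul_self]
  · exact polyIntegral_legendrePoly_mul_of_ne h

/-- The antiderivative of `X * legendrePoly n` that vanishes at `-1`. -/
noncomputable def legendreMoment : ℕ → ℝ[X]
  | 0 => C (1 / 3) * (legendrePoly 2 - legendrePoly 0)
  | 1 => C (2 / 15) * (legendrePoly 3 - legendrePoly 1) +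
      C (1 / 3) * (legendrePoly 1 + legendrePoly 0)
  | n + 2 => C (((n : ℝ) + 3) / ((2 * n + 5) * (2 * n + 7))) *
        (legendrePoly (n + 4) - legendrePoly (n + 2)) +
      C (((n : ℝ) + 2) / ((2 * n + 5) * (2 * n + 3))) * (legendrePoly (n + 2) - legendrePoly n)

theorem eval_legendreMoment_neg_one (n : ℕ) : (legendreMoment n).eval (-1) = 0 := by
  match n with
  | 0 | 1 | n + 2 =>
    simp [legendreMoment, eval_legendrePoly_of_sq_eq_one]
    try ring_nf

theorem derivative_legendreMoment (n : ℕ) :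
    derivative (legendreMoment n) = X * legendrePoly n := by
  match n with
  | 0 =>
    rw [legendreMoment, derivative_C_mul, derivative_sub, derivative_legendrePoly_add_two]
    have h : C (1 / 3 : ℝ) * 3 = 1 := by
      rw [← map_ofNat C 3, ← C_mul]; norm_num
    simp only [legendrePoly_zero, legendrePoly_one, zero_add, Nat.cast_zero, mul_zero, mul_one]
    linear_combination X * h
  | 1 =>
    have h₁ := legendrePoly_recurrence 0
    have h₃ : C (1 / 3 : ℝ) * 3 = 1 := by
      rw [← map_ofNat C 3, ← C_mul]; norm_num
    have h₄ : C (1 / 3 : ℝ) * 2 = C (2 / 15) * 5 := by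
      rw [← map_ofNat C 2, ← map_ofNat C 5, ← C_mul, ← C_mul]; norm_num
    rw [legendreMoment, derivative_add, derivative_C_mul, derivative_C_mul, derivative_sub,
      derivative_legendrePoly_add_two 1]
    simp only [legendrePoly_zero, legendrePoly_one, zero_add, Nat.cast_zero, mul_zero, mul_one,
      derivative_add, derivative_X, derivative_one] at h₁ ⊢
    push_cast at h₁ ⊢
    linear_combination C (1 / 3) * h₁ + X * X * h₃ - legendrePoly 2 * h₄
  | n + 2 =>
    have h₁ := legendrePoly_recurrence (n + 1)
    have h₂ : C (((n : ℝ) + 3) / ((2 * n + 5) * (2 * n + 7))) * (2 * n + 7) =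
        C (1 / (2 * (n : ℝ) + 5)) * (n + 3) := by
      trans C (((n : ℝ) + 3) / ((2 * n + 5) * (2 * n + 7)) * (2 * n + 7))
      · simp [map_ofNat]
      · trans C (1 / (2 * (n : ℝ) + 5) * (n + 3))
        · congr 1
          field_simp
        · simp [map_ofNat]
    have h₃ : C (((n : ℝ) + 2) / ((2 * n + 5) * (2 * n + 3))) * (2 * n + 3) =
        C (1 / (2 * (n : ℝ) + 5)) * (n + 2) := by
      trans C (((n : ℝ) + 2) / ((2 * n + 5) * (2 * n + 3)) * (2 * n + 3))
      · simp [map_ofNat]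
      · trans C (1 / (2 * (n : ℝ) + 5) * (n + 2))
        · congr 1
          field_simp
        · simp [map_ofNat]
    have h₄ : C (1 / (2 * (n : ℝ) + 5)) * (2 * n + 5) = 1 := by
      trans C (1 / (2 * (n : ℝ) + 5) * (2 * n + 5))
      · simp [map_ofNat]
      · rw [← C_1]
        congr 1
        field_simp
    rw [legendreMoment, derivative_add, derivative_C_mul, derivative_C_mul, derivative_sub,
      derivative_sub, derivative_legendrePoly_add_two n, derivative_legendrePoly_add_two (n + 2),
      derivative_legendrePoly_add_two n]
    push_cast at h₁ ⊢
    linear_combination legendrePoly (n + 3) * h₂ + legendrePoly (n + 1) * h₃ +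
      C (1 / (2 * (n : ℝ) + 5)) * h₁ + X * legendrePoly (n + 2) * h₄

theorem polyIntegral_legendrePoly_mul_legendreMoment_zero (m : ℕ) :
    polyIntegral (legendrePoly m * legendreMoment 0) =
      1 / 3 * ((if m = 2 then 2 / 5 else 0) - if m = 0 then 2 else 0) := by
  rw [legendreMoment, mul_left_comm, polyIntegral_C_mul, mul_sub, map_sub,
    polyIntegral_legendrePoly_mul, polyIntegral_legendrePoly_mul]
  norm_num

theorem polyIntegral_legendrePoly_mul_legendreMoment_one (m : ℕ) :
    polyIntegral (legendrePoly m * legendreMoment 1) =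
      2 / 15 * ((if m = 3 then 2 / 7 else 0) - if m = 1 then 2 / 3 else 0) +
      1 / 3 * ((if m = 1 then 2 / 3 else 0) + if m = 0 then 2 else 0) := by
  rw [legendreMoment, mul_add, map_add, mul_left_comm, polyIntegral_C_mul, mul_left_comm,
    polyIntegral_C_mul, mul_sub, map_sub, mul_add, map_add]
  simp only [polyIntegral_legendrePoly_mul]
  norm_num

theorem polyIntegral_legendrePoly_mul_legendreMoment_add_two (m n : ℕ) :
    polyIntegral (legendrePoly m * legendreMoment (n + 2)) =
      ((n : ℝ) + 3) / ((2 * n + 5) * (2 * n + 7)) *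
        ((if m = n + 4 then 2 / (2 * (n : ℝ) + 9) else 0) -
          if m = n + 2 then 2 / (2 * (n : ℝ) + 5) else 0) +
      ((n : ℝ) + 2) / ((2 * n + 5) * (2 * n + 3)) *
        ((if m = n + 2 then 2 / (2 * (n : ℝ) + 5) else 0) -
          if m = n then 2 / (2 * (n : ℝ) + 1) else 0) := by
  rw [legendreMoment, mul_add, map_add, mul_left_comm, polyIntegral_C_mul, mul_left_comm,
    polyIntegral_C_mul, mul_sub (legendrePoly m), map_sub, mul_sub (legendrePoly m), map_sub]
  simp only [polyIntegral_legendrePoly_mul]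
  push_cast
  ring_nf

theorem sqrt_mul_polyIntegral_legendreMoment (B : ℕ → ℕ → ℝ)
    (hB01 : B 0 1 = 1 / Real.sqrt 3)
    (hBsup : ∀ i : ℕ, B (i + 2) i =
      ((i : ℝ) + 1) / ((2 * (i : ℝ) + 3) * Real.sqrt ((2 * (i : ℝ) + 1) * (2 * (i : ℝ) + 5))))
    (hBsub : ∀ i : ℕ, B i (i + 2) =
      -(((i : ℝ) + 2) / ((2 * (i : ℝ) + 3) * Real.sqrt ((2 * (i : ℝ) + 1) * (2 * (i : ℝ) + 5)))))
    (hBdiag : ∀ i : ℕ, B i i = 1 / ((2 * (i : ℝ) - 1) * (2 * (i : ℝ) + 3)))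
    (hBzero : ∀ j2 j1 : ℕ, j2 ≠ j1 → j2 ≠ j1 + 2 → j1 ≠ j2 + 2 → ¬(j2 = 0 ∧ j1 = 1) →
      B j2 j1 = 0) (m n : ℕ) :
    Real.sqrt (2 * m + 1) * Real.sqrt (2 * n + 1) / 2 *
      polyIntegral (legendrePoly m * legendreMoment n) = B m n := by
  match n with
  | 0 =>
    rw [polyIntegral_legendrePoly_mul_legendreMoment_zero]
    by_cases h₂ : m = 2
    · subst h₂
      have h := hBsup 0
      have h5 : Real.sqrt 5 ^ 2 = 5 := Real.sq_sqrt (by norm_num)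
      norm_num at h ⊢
      rw [h]
      field_simp
      linear_combination 3 * h5
    by_cases h₀ : m = 0
    · subst h₀
      rw [hBdiag]
      norm_num
    · rw [hBzero m 0 h₀ h₂ (by omega) (by omega)]
      simp [h₂, h₀]
  | 1 =>
    rw [polyIntegral_legendrePoly_mul_legendreMoment_one]
    have h3 : Real.sqrt 3 ^ 2 = 3 := Real.sq_sqrt (by norm_num)
    by_cases h₃ : m = 3
    · subst h₃
      have h := hBsup 1
      have h7 : Real.sqrt 7 ^ 2 = 7 := Real.sq_sqrt (by norm_num)
      rw [Real.sqrt_mul (by positivity)] at h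
      norm_num at h ⊢
      rw [h]
      field_simp
      rw [h3, h7]
      norm_num
    by_cases h₁ : m = 1
    · subst h₁
      rw [hBdiag]
      norm_num
    by_cases h₀ : m = 0
    · subst h₀
      rw [hB01]
      norm_num
      field_simp
      rw [h3]
    · rw [hBzero m 1 h₁ h₃ (by omega) (by omega)]
      simp [h₃, h₁, h₀]
  | n + 2 =>
    rw [polyIntegral_legendrePoly_mul_legendreMoment_add_two]
    have hs (a : ℝ) (ha : 0 ≤ a) : Real.sqrt (2 * n + a) ^ 2 = 2 * n + a :=
      Real.sq_sqrt (by positivity)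
    by_cases h₄ : m = n + 4
    · subst h₄
      have h := hBsup (n + 2)
      rw [Real.sqrt_mul (by positivity)] at h
      rw [h]
      push_cast
      rw [show 2 * ((n : ℝ) + 4) + 1 = 2 * n + 9 by ring,
        show 2 * ((n : ℝ) + 2) + 1 = 2 * n + 5 by ring,
        show 2 * ((n : ℝ) + 2) + 5 = 2 * n + 9 by ring]
      simp
      field_simp
      rw [hs 9 (by norm_num), hs 5 (by norm_num)]
      field_simp
      ring
    by_cases h₂ : m = n + 2
    · subst h₂
      rw [hBdiag]
      push_cast
      rw [Real.mul_self_sqrt (by positivity)]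
      have h3 : 2 * ((n : ℝ) + 2) - 1 ≠ 0 := by
        rw [show 2 * ((n : ℝ) + 2) - 1 = 2 * n + 3 by ring]
        positivity
      simp
      field_simp
      ring
    by_cases h₀ : m = n
    · subst h₀
      rw [hBsub, Real.sqrt_mul (by positivity)]
      push_cast
      rw [show 2 * ((m : ℝ) + 2) + 1 = 2 * m + 5 by ring]
      simp
      field_simp
      rw [hs 1 (by norm_num), hs 5 (by norm_num)]
    · rw [hBzero m (n + 2) h₂ (by omega) (by omega) (by omega)]
      simp [h₄, h₂, h₀]

theorem integral_sub_mul_legendrePoly {t T : ℝ} (ht : t < T) (n : ℕ) (y : ℝ) :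
    ∫ x in t..y, (t - x) * (legendrePoly n).eval ((2 * (x - t) - (T - t)) / (T - t)) =
      -((T - t) / 2) *
          (∫ x in t..y, (legendrePoly n).eval ((2 * (x - t) - (T - t)) / (T - t))) -
        (T - t) ^ 2 / 4 * (legendreMoment n).eval ((2 * (y - t) - (T - t)) / (T - t)) := by
  have hΔ : T - t ≠ 0 := sub_ne_zero.mpr ht.ne'
  have hderiv (x : ℝ) : HasDerivAt
      (fun x => -((T - t) ^ 2 / 4) * (legendreMoment n).eval ((2 * (x - t) - (T - t)) / (T - t)))
      ((t - x) * (legendrePoly n).eval ((2 * (x - t) - (T - t)) / (T - t)) +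
        (T - t) / 2 * (legendrePoly n).eval ((2 * (x - t) - (T - t)) / (T - t))) x := by
    have h₁ : HasDerivAt (fun x : ℝ => (2 * (x - t) - (T - t)) / (T - t)) (2 * 1 / (T - t)) x :=
      ((((hasDerivAt_id x).sub_const t).const_mul 2).sub_const (T - t)).div_const (T - t)
    have h₂ := (((legendreMoment n).hasDerivAt _).comp x h₁).const_mul (-((T - t) ^ 2 / 4))
    rw [derivative_legendreMoment, eval_mul, eval_X] at h₂
    refine h₂.congr_deriv ?_
    field_simp
    ring
  have h := intervalIntegral.integral_eq_sub_of_hasDerivAt (fun x _ => hderiv x)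
    (Continuous.intervalIntegrable (by fun_prop) t y)
  rw [intervalIntegral.integral_add (Continuous.intervalIntegrable (by fun_prop) t y)
    (Continuous.intervalIntegrable (by fun_prop) t y), intervalIntegral.integral_const_mul] at h
  have h₀ : (2 * (t - t) - (T - t)) / (T - t) = -1 := by
    field_simp
    ring
  rw [h₀, eval_legendreMoment_neg_one] at h
  linear_combination h

theorem integral_eval_rescaled {t T : ℝ} (ht : t < T) (p : ℝ[X]) :
    ∫ y in t..T, p.eval ((2 * (y - t) - (T - t)) / (T - t)) = (T - t) / 2 * polyIntegral p := by
  have hΔ : T - t ≠ 0 := sub_ne_zero.mpr ht.ne'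
  have h := intervalIntegral.integral_comp_mul_add (a := t) (b := T) (fun x => p.eval x)
    (c := 2 / (T - t)) (by positivity) (-(2 * t + (T - t)) / (T - t))
  have h₁ (y : ℝ) : 2 / (T - t) * y + -(2 * t + (T - t)) / (T - t) =
      (2 * (y - t) - (T - t)) / (T - t) := by
    field_simp
    ring
  simp only [h₁] at h
  rw [h, polyIntegral_apply, smul_eq_mul, inv_div]
  congr 2 <;> field_simp <;> ring

/-- Fourier–Legendre coefficients of the kernel of the double stochastic integral `I₁₀`
with weight `(t−t₁)` on the inner variable:
`C¹⁰_{j₂j₁} = −(Δ/2)·C_{j₂j₁} − (Δ²/4)·B_{j₂j₁}` with the explicit matrix `B`. -/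
theorem stmt_12 (t T : ℝ) (ht : t < T)
    (φ : ℕ → ℝ → ℝ)
    (hφ : ∀ (n : ℕ) (x : ℝ), φ n x =
      Real.sqrt ((2 * (n : ℝ) + 1) / (T - t)) *
        legendreP n ((2 * (x - t) - (T - t)) / (T - t)))
    (C : ℕ → ℕ → ℝ)
    (hC : ∀ j2 j1 : ℕ, C j2 j1 = ∫ y in t..T, φ j2 y * ∫ x in t..y, φ j1 x)
    (C10 : ℕ → ℕ → ℝ)
    (hC10 : ∀ j2 j1 : ℕ,
      C10 j2 j1 = ∫ t2 in t..T, φ j2 t2 * ∫ t1 in t..t2, (t - t1) * φ j1 t1)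
    (B : ℕ → ℕ → ℝ)
    (hB01 : B 0 1 = 1 / Real.sqrt 3)
    (hBsup : ∀ i : ℕ, B (i + 2) i =
      ((i : ℝ) + 1) / ((2 * (i : ℝ) + 3) * Real.sqrt ((2 * (i : ℝ) + 1) * (2 * (i : ℝ) + 5))))
    (hBsub : ∀ i : ℕ, B i (i + 2) =
      -(((i : ℝ) + 2) / ((2 * (i : ℝ) + 3) * Real.sqrt ((2 * (i : ℝ) + 1) * (2 * (i : ℝ) + 5)))))
    (hBdiag : ∀ i : ℕ, B i i = 1 / ((2 * (i : ℝ) - 1) * (2 * (i : ℝ) + 3)))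
    (hBzero : ∀ j2 j1 : ℕ, j2 ≠ j1 → j2 ≠ j1 + 2 → j1 ≠ j2 + 2 → ¬(j2 = 0 ∧ j1 = 1) →
      B j2 j1 = 0) :
    ∀ j2 j1 : ℕ,
      C10 j2 j1 = -((T - t) / 2) * C j2 j1 - ((T - t) ^ 2 / 4) * B j2 j1 := by
  intro j2 j1
  have hΔ : 0 < T - t := sub_pos.mpr ht
  have hu : Continuous fun x : ℝ => (2 * (x - t) - (T - t)) / (T - t) := by fun_prop
  have hcont (n : ℕ) : Continuous (φ n) := by
    rw [funext (hφ n)]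
    simp only [legendreP_eq_eval]
    exact continuous_const.mul ((legendrePoly n).continuous.comp hu)
  have hinner (y : ℝ) : ∫ x in t..y, (t - x) * φ j1 x = -((T - t) / 2) * (∫ x in t..y, φ j1 x) -
      (T - t) ^ 2 / 4 * (Real.sqrt ((2 * (j1 : ℝ) + 1) / (T - t)) *
        (legendreMoment j1).eval ((2 * (y - t) - (T - t)) / (T - t))) := by
    simp only [hφ, legendreP_eq_eval, mul_left_comm _ (Real.sqrt _),
      intervalIntegral.integral_const_mul]
    rw [integral_sub_mul_legendrePoly ht]
    ring
  have hprim : Continuous fun y => ∫ x in t..y, φ j1 x :=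
    intervalIntegral.continuous_primitive (fun a b => (hcont j1).intervalIntegrable a b) t
  have hpoly : ∫ y in t..T, φ j2 y * (legendreMoment j1).eval ((2 * (y - t) - (T - t)) / (T - t)) =
      Real.sqrt ((2 * (j2 : ℝ) + 1) / (T - t)) *
        ((T - t) / 2 * polyIntegral (legendrePoly j2 * legendreMoment j1)) := by
    rw [← integral_eval_rescaled ht, ← intervalIntegral.integral_const_mul]
    simp only [hφ, legendreP_eq_eval, eval_mul, mul_assoc]
  have hsplit : C10 j2 j1 = -((T - t) / 2) * C j2 j1 - (T - t) ^ 2 / 4 *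
      Real.sqrt ((2 * (j1 : ℝ) + 1) / (T - t)) *
      ∫ y in t..T, φ j2 y * (legendreMoment j1).eval ((2 * (y - t) - (T - t)) / (T - t)) := by
    rw [hC10, hC, ← intervalIntegral.integral_const_mul, ← intervalIntegral.integral_const_mul,
      ← intervalIntegral.integral_sub]
    · congr 1
      ext y
      rw [hinner]
      ring
    · exact (continuous_const.mul ((hcont j2).mul hprim)).intervalIntegrable _ _
    · exact (continuous_const.mul ((hcont j2).mul
        ((legendreMoment j1).continuous.comp hu))).intervalIntegrable _ _
  rw [hsplit, hpoly, ← sqrt_mul_polyIntegral_legendreMoment B hB01 hBsup hBsub hBdiag hBzero,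
    Real.sqrt_div (by positivity), Real.sqrt_div (by positivity)]
  have hs : Real.sqrt (T - t) ^ 2 = T - t := Real.sq_sqrt hΔ.le
  field_simp
  rw [hs]
  ring
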